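/- Let μ be a singular cardinal with cf(μ) = ℵ₀ and let λ = μ⁺. Let ⟨λ_n : n < ω⟩ be a strictly increasing sequence of regular cardinals, each greater than ℵ₁, with supremum μ, and let ⟨f_α : α < λ⟩ be a sequence witnessing λ = tcf(∏_n λ_n, <_{J^bd_ω}) which is moreover ℵ₂-free. Then there exists a stationary family 𝒜 ⊆ [λ]^{ℵ₀} that does not reflect in any set A ⊆ λ of cardinality ℵ₁. -/

import Mathlib

open Cardinal Set

namespace ReflSCH

/-- `[B]^{<ℵ₁}`: the family of subsets of `B` of cardinality `< ℵ₁`,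
i.e. the countable subsets of `B`. -/
def small (B : Set Ordinal.{0}) : Set (Set Ordinal.{0}) := {a | a ⊆ B ∧ a.Countable}

/-- `[B]^{ℵ₀}`: the countably infinite subsets of `B`. -/
def ctblInf (B : Set Ordinal.{0}) : Set (Set Ordinal.{0}) :=
  {a | a ⊆ B ∧ a.Countable ∧ a.Infinite}

/-- A family is closed if the union of every nonempty `⊆`-increasing chain of fewer
than `ℵ₁` (i.e. countably many) of its members belongs to it. -/
def ClosedFam (𝒜 : Set (Set Ordinal.{0})) : Prop :=
  ∀ D : Set (Set Ordinal.{0}), D ⊆ 𝒜 → D.Nonempty → IsChain (· ⊆ ·) D → D.Countable →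
    ⋃₀ D ∈ 𝒜

/-- A family is unbounded in `[B]^{<ℵ₁}` if every member of `[B]^{<ℵ₁}` is contained in
some member of the family. -/
def UnbFam (B : Set Ordinal.{0}) (𝒜 : Set (Set Ordinal.{0})) : Prop :=
  ∀ y ∈ small B, ∃ x ∈ 𝒜, y ⊆ x

/-- A club of `[B]^{<ℵ₁}`. -/
def ClubFam (B : Set Ordinal.{0}) (𝒜 : Set (Set Ordinal.{0})) : Prop :=
  𝒜 ⊆ small B ∧ ClosedFam 𝒜 ∧ UnbFam B 𝒜

/-- The family `𝒜` meets every club of `[B]^{<ℵ₁}`. -/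
def MeetsClubs (B : Set Ordinal.{0}) (𝒜 : Set (Set Ordinal.{0})) : Prop :=
  ∀ 𝒞 : Set (Set Ordinal.{0}), ClubFam B 𝒞 → (𝒜 ∩ 𝒞).Nonempty

/-- Stationarity in `[B]^{<ℵ₁}`. -/
def StatFam (B : Set Ordinal.{0}) (𝒜 : Set (Set Ordinal.{0})) : Prop :=
  𝒜 ⊆ small B ∧ MeetsClubs B 𝒜

/-- `𝒜` reflects in `B₂` iff `𝒜 ∩ [B₂]^{ℵ₀}` is stationary in `[B₂]^{<ℵ₁}`. -/
def Reflects (𝒜 : Set (Set Ordinal.{0})) (B₂ : Set Ordinal.{0}) : Prop :=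
  StatFam B₂ (𝒜 ∩ ctblInf B₂)

/-- `f <_{J^{bd}_ω} g`: `f n < g n` for all but finitely many `n`. -/
def ltBd (f g : ℕ → Ordinal.{0}) : Prop := ∃ m : ℕ, ∀ n ≥ m, f n < g n

/-- `⟨f_α : α < lam.ord⟩` witnesses `lam = tcf (∏_n lamseq n, <_{J^{bd}_ω})`:
each `f_α ∈ ∏_n lamseq n`, the sequence is `<_{J^{bd}_ω}`-increasing, and it is
cofinal in the product. -/
def TcfWitness (lam : Cardinal.{0}) (lamseq : ℕ → Cardinal.{0})
    (f : Ordinal.{0} → ℕ → Ordinal.{0}) : Prop :=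
  (∀ α < lam.ord, ∀ n : ℕ, f α n < (lamseq n).ord) ∧
  (∀ α < lam.ord, ∀ β < lam.ord, α < β → ltBd (f α) (f β)) ∧
  (∀ g : ℕ → Ordinal.{0}, (∀ n : ℕ, g n < (lamseq n).ord) → ∃ α < lam.ord, ltBd g (f α))

/-- The sequence `⟨f_i : i ∈ I⟩` is free. -/
def Free (I : Set Ordinal.{0}) (f : Ordinal.{0} → ℕ → Ordinal.{0}) : Prop :=
  ∃ nf : Ordinal.{0} → ℕ, ∀ i ∈ I, ∀ j ∈ I, i < j →
    ∀ n : ℕ, nf i ≤ n → nf j ≤ n → f i n < f j n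

/-- `ω₁` as an ordinal. -/
noncomputable abbrev w1 : Ordinal.{0} := (Cardinal.aleph 1).ord

theorem bd (c : Cardinal.{0}) (hc : c.IsRegular) {ι : Type 1} (F : ι → Ordinal.{0})
    (h : #ι < Cardinal.lift.{1} c) : ∃ b < c.ord, ∀ i, F i < c.ord → F i < b := by
  classical
  have hpos : 0 < c.ord := by
    rw [Cardinal.lt_ord]; simpa using hc.pos
  have hlim : Order.IsSuccLimit c.ord := Cardinal.isSuccLimit_ord hc.aleph0_le
  have hS : (⨆ i, if F i < c.ord then F i else 0) < c.ord := by
    apply Ordinal.lift_iSup_lt_of_lt_cof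
    · rw [← Ordinal.lift_cof, hc.cof_ord, Cardinal.lift_uzero]; exact h
    · intro i
      split_ifs with hi
      · exact hi
      · exact hpos
  have hsm : Small.{0} ι := by
    rw [Cardinal.small_iff_lift_mk_lt_univ]
    rw [Cardinal.lift_id]
    refine h.trans ?_
    exact Cardinal.lift_lt_univ c
  refine ⟨Order.succ (⨆ i, if F i < c.ord then F i else 0), hlim.succ_lt hS, fun i hi => ?_⟩
  rw [Order.lt_succ_iff]
  have := Ordinal.le_iSup (fun i => if F i < c.ord then F i else 0) i
  simpa [hi] using this

theorem reg1 : (Cardinal.aleph 1 : Cardinal.{0}).IsRegular := Cardinal.isRegular_aleph_one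

theorem bd1 {ι : Type 1} [Countable ι] (F : ι → Ordinal.{0}) :
    ∃ b < w1, ∀ i, F i < w1 → F i < b := by
  apply bd _ reg1
  refine (Cardinal.mk_le_aleph0).trans_lt ?_
  rw [← Cardinal.lift_aleph0.{1,0}, Cardinal.lift_lt]
  exact Cardinal.aleph0_lt_aleph_one

theorem bd1N (F : ℕ → Ordinal.{0}) :
    ∃ b < w1, ∀ i, F i < w1 → F i < b := by
  obtain ⟨b, hb, h⟩ := bd1 (fun i : ULift.{1} ℕ => F i.down)
  exact ⟨b, hb, fun i => h ⟨i⟩⟩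

theorem ctble_Iio {i : Ordinal.{0}} (hi : i < w1) : (Set.Iio i).Countable := by
  rw [← Cardinal.le_aleph0_iff_set_countable, Cardinal.mk_Iio_ordinal,
    ← Cardinal.lift_aleph0.{1,0}, Cardinal.lift_le]
  rw [Cardinal.lt_ord] at hi
  rwa [← Cardinal.succ_aleph0, Order.lt_succ_iff] at hi

theorem w1_pos : 0 < w1 := by
  rw [Cardinal.lt_ord]; simp

theorem w1_succ {i : Ordinal.{0}} (hi : i < w1) : Order.succ i < w1 :=
  (Cardinal.isSuccLimit_ord reg1.aleph0_le).succ_lt hi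

/-- Stationarity in ω₁, in terms of closure under functions. -/
def St (T : Set Ordinal.{0}) : Prop :=
  ∀ φ : Ordinal.{0} → Ordinal.{0}, (∀ j < w1, φ j < w1) →
    ∃ i ∈ T, 0 < i ∧ i < w1 ∧ ∀ j < i, φ j < i

theorem St_union {T : Set Ordinal.{0}} (hT : St T) (g : Ordinal.{0} → ℕ) :
    ∃ m, St {i ∈ T | g i ≤ m} := by
  by_contra hcon
  push Not at hcon
  have : ∀ m, ∃ φ : Ordinal.{0} → Ordinal.{0}, (∀ j < w1, φ j < w1) ∧
    ∀ i ∈ T, g i ≤ m → 0 < i → i < w1 → ∃ j < i, i ≤ φ j := by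
    intro m
    have := hcon m
    unfold St at this
    push Not at this
    obtain ⟨φ, h1, h2⟩ := this
    exact ⟨φ, h1, fun i hi hm h0 h => h2 i ⟨hi, hm⟩ h0 h⟩
  choose φ h1 h2 using this
  choose ψ p1 p2 using fun j => bd1N (fun m => φ m j)
  obtain ⟨i, hi, h0, hi1, hc⟩ := hT ψ (fun j _ => p1 j)
  obtain ⟨j, hj, hj2⟩ := h2 (g i) i hi le_rfl h0 hi1
  exact absurd (hc j hj) (not_lt.2 (hj2.trans (p2 j (g i) (h1 _ j (hj.trans hi1))).le))

/-- closure points exist -/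
theorem clo (φ : Ordinal.{0} → Ordinal.{0}) (hφ : ∀ j < w1, φ j < w1) (i0 : Ordinal.{0})
    (hi0 : i0 < w1) : ∃ i, i0 < i ∧ i < w1 ∧ ∀ j < i, φ j < i := by
  have step : ∀ i : Ordinal.{0}, ∃ b, i < w1 → i < b ∧ b < w1 ∧ ∀ j < i, φ j < b := by
    intro i
    by_cases hi : i < w1
    · have : Countable (Set.Iio i) := (ctble_Iio hi).to_subtype
      obtain ⟨b, hb, h⟩ := bd1 (fun j : Set.Iio i => φ j)
      refine ⟨max b (Order.succ i), fun _ => ⟨?_, ?_, ?_⟩⟩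
      · exact lt_max_of_lt_right (Order.lt_succ i)
      · exact max_lt hb (w1_succ hi)
      · intro j hj
        exact lt_max_of_lt_left (h ⟨j, hj⟩ (hφ j (hj.trans hi)))
    · exact ⟨0, fun h => absurd h hi⟩
  choose s hs using step
  let t : ℕ → Ordinal.{0} := fun n => s^[n] i0
  have ht : ∀ n, t n < w1 := by
    intro n
    induction n with
    | zero => exact hi0
    | succ n ih =>
      simp only [t, Function.iterate_succ_apply']
      exact (hs _ ih).2.1
  have ht2 : ∀ n, t (n+1) = s (t n) := fun n => Function.iterate_succ_apply' _ _ _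
  obtain ⟨b, hb, hb2⟩ := bd1N t
  have hle : ∀ n, t n ≤ ⨆ n, t n := fun n => Ordinal.le_iSup t n
  refine ⟨⨆ n, t n, ?_, ?_, ?_⟩
  · refine lt_of_lt_of_le ?_ (hle 1)
    rw [ht2]; exact (hs _ (ht 0)).1
  · exact lt_of_le_of_lt (Ordinal.iSup_le fun n => (hb2 n (ht n)).le) hb
  · intro j hj
    obtain ⟨n, hn⟩ := (Ordinal.lt_iSup_iff).1 hj
    refine lt_of_lt_of_le ?_ (hle (n+1))
    rw [ht2]; exact (hs _ (ht n)).2.2 j hn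

theorem St_of_reflects {𝒜 : Set (Set Ordinal.{0})} {A : Set Ordinal.{0}}
    (x : Ordinal.{0} → Ordinal.{0}) (hx : x '' Set.Iio w1 = A) (h : Reflects 𝒜 A) :
    St {i | x '' Set.Iio i ∈ 𝒜} := by
  intro φ hφ
  have hclub : ClubFam A {a | ∃ i, 0 < i ∧ i < w1 ∧ (∀ j < i, φ j < i) ∧ a = x '' Set.Iio i} := by
    refine ⟨?_, ?_, ?_⟩
    · rintro a ⟨i, h0, hi, hc, rfl⟩
      refine ⟨?_, (ctble_Iio hi).image _⟩
      rw [← hx]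
      exact Set.image_mono (fun j hj => lt_trans hj hi)
    · intro D hD hne _ hDc
      have hD' : ∀ a : D, ∃ i, 0 < i ∧ i < w1 ∧ (∀ j < i, φ j < i) ∧ a.1 = x '' Set.Iio i :=
        fun a => hD a.2
      choose i h0 h1 h2 h3 using hD'
      have : Countable D := hDc.to_subtype
      obtain ⟨b, hb, hb2⟩ := bd1 i
      have hbdd : BddAbove (Set.range i) := ⟨b, by rintro _ ⟨a, rfl⟩; exact (hb2 a (h1 a)).le⟩
      have hle : ∀ a, i a ≤ ⨆ a, i a := fun a => le_ciSup hbdd a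
      obtain ⟨a0, ha0⟩ := hne
      have : Nonempty D := ⟨⟨a0, ha0⟩⟩
      refine ⟨⨆ a, i a, lt_of_lt_of_le (h0 ⟨a0, ha0⟩) (hle _), ?_, ?_, ?_⟩
      · exact lt_of_le_of_lt (ciSup_le fun a => (hb2 a (h1 a)).le) hb
      · intro j hj
        obtain ⟨a, ha⟩ := exists_lt_of_lt_ciSup hj
        exact lt_of_lt_of_le (h2 a j ha) (hle a)
      · ext y
        constructor
        · rintro ⟨a, haD, hya⟩
          have e := h3 ⟨a, haD⟩
          simp only at e
          rw [e] at hya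
          obtain ⟨j, hj, rfl⟩ := hya
          exact ⟨j, lt_of_lt_of_le hj (hle _), rfl⟩
        · rintro ⟨j, hj, rfl⟩
          obtain ⟨a, ha⟩ := exists_lt_of_lt_ciSup (Set.mem_Iio.1 hj)
          refine ⟨a.1, a.2, ?_⟩
          rw [h3 a]
          exact ⟨j, ha, rfl⟩
    · rintro y ⟨hyA, hyc⟩
      have : ∀ z : y, ∃ j < w1, x j = z.1 := by
        intro z
        have := hyA z.2
        rw [← hx] at this
        exact this
      choose j hj hj2 using this
      have : Countable y := hyc.to_subtype
      obtain ⟨b, hb, hb2⟩ := bd1 j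
      obtain ⟨i, hi0, hi1, hi2⟩ := clo φ hφ b hb
      refine ⟨_, ⟨i, (zero_le (a := b)).trans_lt hi0, hi1, hi2, rfl⟩, ?_⟩
      intro z hz
      exact ⟨j ⟨z, hz⟩, (hb2 _ (hj _)).trans hi0, hj2 _⟩
  obtain ⟨a, ⟨haA, _⟩, i, h0, hi, hc, rfl⟩ := h.2 _ hclub
  exact ⟨i, haA, h0, hi, hc⟩

/-- an uncountable set of ordinals not all of whose countable subsets embed in a fixed ξ -/
theorem no_embed (A : Set Ordinal.{0}) (hA : ¬ A.Countable) (ξ : Ordinal.{0}) (hξ : ξ < w1)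
    (h : ∀ a ⊆ A, a.Countable → ∃ z : Ordinal.{0} → Ordinal.{0}, (∀ x ∈ a, z x < ξ) ∧
      ∀ x ∈ a, ∀ y ∈ a, x < y → z x < z y) : False := by
  let X := {x ∈ A | (A ∩ Set.Iio x).Countable}
  have hX : ¬ X.Countable := by
    intro hX
    have : (A \ X).Nonempty := by
      by_contra hne
      rw [Set.not_nonempty_iff_eq_empty, Set.sdiff_eq_empty] at hne
      exact hA (hX.mono hne)
    have hm := csInf_mem this
    refine hm.2 ⟨hm.1, hX.mono ?_⟩
    rintro y ⟨hy, hy2⟩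
    by_contra hyX
    exact absurd (csInf_le (OrderBot.bddBelow _) (show y ∈ A \ X from ⟨hy, hyX⟩)) (not_le.2 hy2)
  let E : Ordinal.{0} → Set Ordinal.{0} := fun x => {o | ∃ z : Ordinal.{0} → Ordinal.{0},
    (∀ y ∈ A ∩ Set.Iic x, z y < ξ) ∧
      (∀ y ∈ A ∩ Set.Iic x, ∀ y' ∈ A ∩ Set.Iic x, y < y' → z y < z y') ∧ o = z x}
  have hE : ∀ x ∈ X, (E x).Nonempty := by
    rintro x ⟨hxA, hx⟩
    have : (A ∩ Set.Iic x).Countable := by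
      refine (hx.union (Set.countable_singleton x)).mono ?_
      rintro y ⟨hy, hy2⟩
      rcases lt_or_eq_of_le (Set.mem_Iic.1 hy2) with h | h
      · exact Or.inl ⟨hy, h⟩
      · exact Or.inr h
    obtain ⟨z, h1, h2⟩ := h _ Set.inter_subset_left this
    exact ⟨_, z, h1, h2, rfl⟩
  have hlt : ∀ x ∈ X, ∀ y ∈ X, x < y → sInf (E x) < sInf (E y) := by
    intro x hx y hy hxy
    obtain ⟨z, h1, h2, h3⟩ := csInf_mem (hE y hy)
    rw [h3]
    refine lt_of_le_of_lt (csInf_le (OrderBot.bddBelow _) (show z x ∈ E x from ⟨z, ?_, ?_, rfl⟩)) ?_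
    · exact fun u hu => h1 u ⟨hu.1, le_trans hu.2 hxy.le⟩
    · exact fun u hu v hv => h2 u ⟨hu.1, le_trans hu.2 hxy.le⟩ v ⟨hv.1, le_trans hv.2 hxy.le⟩
    · exact h2 x ⟨hx.1, hxy.le⟩ y ⟨hy.1, le_refl y⟩ hxy
  apply hX
  have hmaps : Set.MapsTo (fun x => sInf (E x)) X (Set.Iio ξ) := by
    intro x hx
    obtain ⟨z, h1, h2, h3⟩ := csInf_mem (hE x hx)
    simp only [Set.mem_Iio]
    rw [h3]
    exact h1 x ⟨hx.1, le_refl x⟩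
  refine Set.MapsTo.countable_of_injOn hmaps ?_ (ctble_Iio hξ)
  intro x hx y hy hxy
  rcases lt_trichotomy x y with h | h | h
  · exact absurd hxy (hlt x hx y hy h).ne
  · exact h
  · exact absurd hxy (hlt y hy x hx h).ne'

/-- the set of coordinates at which `a` is dominated by `f (sup a)` -/
def uset (lamseq : ℕ → Cardinal.{0}) (f : Ordinal.{0} → ℕ → Ordinal.{0}) (a : Set Ordinal.{0}) :
    Set ℕ := {n | ∀ γ ∈ a, γ < (lamseq n).ord → γ < f (sSup a) n}

/-- the family -/
def fam (lam : Cardinal.{0}) (lamseq : ℕ → Cardinal.{0}) (f : Ordinal.{0} → ℕ → Ordinal.{0})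
    (U : Ordinal.{0} → Set ℕ) : Set (Set Ordinal.{0}) :=
  {a | a ∈ ctblInf (Set.Iio lam.ord) ∧ ∃ ξ < w1,
    (∃ m, ∀ n ≥ m, (n ∈ uset lamseq f a ↔ n ∈ U ξ)) ∧
    ∃ z : Ordinal.{0} → Ordinal.{0}, (∀ x ∈ a, z x < ξ) ∧
      ∀ x ∈ a, ∀ y ∈ a, x < y → z x < z y}

theorem exists_U : ∃ U : Ordinal.{0} → Set ℕ, ∀ ξ < w1, ∀ ξ' < w1,
    (∃ m, ∀ n ≥ m, (n ∈ U ξ ↔ n ∈ U ξ')) → ξ = ξ' := by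
  have : Cardinal.lift.{0} #(Set.Iio w1) ≤ Cardinal.lift.{1} #(Set ℕ) := by
    rw [Cardinal.mk_Iio_ordinal]
    simpa using Cardinal.aleph_one_le_continuum
  obtain ⟨e⟩ := Cardinal.lift_mk_le'.1 this
  classical
  refine ⟨fun ξ => if h : ξ < w1 then {n | n.unpair.1 ∈ e ⟨ξ, h⟩} else ∅, ?_⟩
  rintro ξ hξ ξ' hξ' ⟨m, hm⟩
  simp only [hξ, hξ', dif_pos, Set.mem_ofPred_eq] at hm
  have : e ⟨ξ, hξ⟩ = e ⟨ξ', hξ'⟩ := by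
    ext k
    simpa using hm (Nat.pair k m) (Nat.right_le_pair k m)
  exact congrArg Subtype.val (e.injective this)

theorem not_reflects (lam : Cardinal.{0}) (lamseq : ℕ → Cardinal.{0})
    (f : Ordinal.{0} → ℕ → Ordinal.{0}) (U : Ordinal.{0} → Set ℕ)
    (hU : ∀ ξ < w1, ∀ ξ' < w1, (∃ m, ∀ n ≥ m, (n ∈ U ξ ↔ n ∈ U ξ')) → ξ = ξ')
    (hlim : Order.IsSuccLimit lam.ord) (hlreg : lam.IsRegular) (h1 : Cardinal.aleph 1 < lam)
    (hfree : ∀ I : Set Ordinal.{0}, I ⊆ Set.Iio lam.ord →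
      #I ≤ Cardinal.aleph 1 → Free I f)
    (A : Set Ordinal.{0}) (hA : A ⊆ Set.Iio lam.ord) (hA1 : #A = Cardinal.aleph 1) :
    ¬ Reflects (fam lam lamseq f U) A := by
  intro hR
  have hcard : #(Set.Iio w1) = #A := by
    rw [hA1, Cardinal.mk_Iio_ordinal]; simp
  obtain ⟨e⟩ := Cardinal.eq.1 hcard
  classical
  obtain ⟨x, hx⟩ : ∃ x : Ordinal.{0} → Ordinal.{0}, x '' Set.Iio w1 = A := by
    refine ⟨fun i => if h : i < w1 then (e ⟨i, h⟩).1 else 0, ?_⟩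
    ext y
    constructor
    · rintro ⟨i, hi, rfl⟩
      have hi' : i < w1 := hi
      simp only [dif_pos hi', Subtype.coe_prop]
    · intro hy
      refine ⟨(e.symm ⟨y, hy⟩).1, (e.symm ⟨y, hy⟩).2, ?_⟩
      have : (e.symm ⟨y, hy⟩).1 < w1 := (e.symm ⟨y, hy⟩).2
      simp only [dif_pos this]
      exact congrArg Subtype.val (e.apply_symm_apply ⟨y, hy⟩)
  have hxA : ∀ j < w1, x j ∈ A := fun j hj => hx ▸ ⟨j, hj, rfl⟩
  have hT := St_of_reflects x hx hR
  set a : Ordinal.{0} → Set Ordinal.{0} := fun i => x '' Set.Iio i with ha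
  obtain ⟨bA, hbA, hbA2⟩ : ∃ b < lam.ord, ∀ y ∈ A, y < b := by
    obtain ⟨b, hb, h⟩ := bd lam hlreg (fun y : A => y.1) (by
      rw [hA1]
      simpa using Cardinal.lift_lt.{0,1}.2 h1)
    exact ⟨b, hb, fun y hy => h ⟨y, hy⟩ (hA hy)⟩
  have haA : ∀ i < w1, a i ⊆ A := by
    rintro i hi _ ⟨j, hj, rfl⟩
    exact hxA j (lt_trans hj hi)
  have habdd : ∀ i < w1, BddAbove (a i) := fun i hi => ⟨bA, fun y hy => (hbA2 y (haA i hi hy)).le⟩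
  have hδ : ∀ i < w1, sSup (a i) < lam.ord := by
    intro i hi
    refine lt_of_le_of_lt ?_ hbA
    exact csSup_le' fun y hy => (hbA2 y (haA i hi hy)).le
  have hδmono : ∀ i j, i ≤ j → j < w1 → sSup (a i) ≤ sSup (a j) := by
    intro i j hij hj
    exact csSup_le_csSup' (habdd j hj) (Set.image_mono fun k hk => lt_of_lt_of_le hk hij)
  obtain ⟨nf, hnf⟩ := hfree ((fun i => sSup (a i)) '' Set.Iio w1)
    (by rintro _ ⟨i, hi, rfl⟩; exact hδ i hi)
    (by
      refine Cardinal.mk_image_le.trans ?_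
      rw [hcard, hA1])
  obtain ⟨m, hm⟩ := St_union hT (fun i => nf (sSup (a i)))
  set T := {i ∈ {i | x '' Set.Iio i ∈ fam lam lamseq f U} | nf (sSup (a i)) ≤ m} with hTdef
  let B : Set ℕ := {n | ∃ γ ∈ A, γ < (lamseq n).ord ∧ ∀ i ∈ T, i < w1 → f (sSup (a i)) n ≤ γ}
  have hν : ∀ n, ∃ ν, ν < w1 ∧ (n ∈ B → x ν < (lamseq n).ord ∧
      ∀ i ∈ T, i < w1 → f (sSup (a i)) n ≤ x ν) := by
    intro n
    by_cases hn : n ∈ B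
    · obtain ⟨γ, hγA, hγ⟩ := hn
      rw [← hx] at hγA
      obtain ⟨ν, hν, rfl⟩ := hγA
      exact ⟨ν, hν, fun _ => hγ⟩
    · exact ⟨0, w1_pos, fun h => absurd h hn⟩
  choose ν hν1 hν2 using hν
  obtain ⟨b0, hb0, hb0'⟩ := bd1N ν
  have hι : ∀ j n, ∃ i, i < w1 ∧ (j < w1 → n ∉ B → x j < (lamseq n).ord →
      i ∈ T ∧ x j < f (sSup (a i)) n) := by
    intro j n
    by_cases hh : j < w1 ∧ n ∉ B ∧ x j < (lamseq n).ord
    · obtain ⟨hj, hn, hxn⟩ := hh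
      by_contra hcon
      apply hn
      refine ⟨x j, hxA j hj, hxn, fun i hi hiw => ?_⟩
      by_contra hlt
      exact hcon ⟨i, hiw, fun _ _ _ => ⟨hi, not_le.1 hlt⟩⟩
    · exact ⟨0, w1_pos, fun h1 h2 h3 => absurd ⟨h1, h2, h3⟩ hh⟩
  choose ι hι1 hι2 using hι
  choose b1 hb1 hb1' using fun j => bd1N (ι j)
  -- key claim
  have key : ∀ i ∈ T, 0 < i → i < w1 → (∀ j < i, max b0 (b1 j) < i) →
      ∀ n ≥ m, (n ∈ uset lamseq f (a i) ↔ n ∉ B) := by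
    intro i hiT h0 hi hc n hn
    constructor
    · intro hu hB
      have h2 := hν2 n hB
      have hνi : ν n < i := (hb0' n (hν1 n)).trans ((le_max_left _ _).trans_lt (hc 0 h0))
      exact absurd (hu (x (ν n)) ⟨ν n, hνi, rfl⟩ h2.1) (not_lt.2 (h2.2 i hiT hi))
    · rintro hB _ ⟨j, hj, rfl⟩ hlt
      have hj' : j < i := hj
      obtain ⟨q1, q2⟩ := hι2 j n (hj'.trans hi) hB hlt
      have hii : ι j n < i := (hb1' j n (hι1 j n)).trans ((le_max_right _ _).trans_lt (hc j hj'))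
      rcases lt_or_eq_of_le (hδmono _ _ hii.le hi) with h | h
      · refine q2.trans (hnf _ ⟨_, hι1 j n, rfl⟩ _ ⟨i, hi, rfl⟩ h n ?_ ?_)
        · exact q1.2.trans hn
        · exact hiT.2.trans hn
      · rw [← h]; exact q2
  have gen : ∀ k < w1, ∃ i ∈ T, k < i ∧ i < w1 ∧
      ∀ n ≥ m, (n ∈ uset lamseq f (a i) ↔ n ∉ B) := by
    intro k hk
    obtain ⟨i, hiT, h0, hi, hc⟩ := hm (fun j => max k (max b0 (b1 j)))
      (fun j _ => max_lt hk (max_lt hb0 (hb1 j)))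
    refine ⟨i, hiT, (le_max_left _ _).trans_lt (hc 0 h0), hi, key i hiT h0 hi ?_⟩
    exact fun j hj => (le_max_right _ _).trans_lt (hc j hj)
  obtain ⟨i0, hi0T, -, -, hi0⟩ := gen 0 w1_pos
  obtain ⟨-, ξ, hξ, ⟨m0, hm0⟩, -⟩ := hi0T.1
  refine no_embed A ?_ ξ hξ ?_
  · rw [← Cardinal.le_aleph0_iff_set_countable, hA1, not_le]
    exact Cardinal.aleph0_lt_aleph_one
  · intro c hcA hcc
    have : ∀ z : c, ∃ j < w1, x j = z.1 := by
      intro z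
      have := hcA z.2
      rw [← hx] at this
      exact this
    choose j hj hj2 using this
    have : Countable c := hcc.to_subtype
    obtain ⟨b, hb, hb2⟩ := bd1 j
    obtain ⟨i, hiT, hki, hi, hin⟩ := gen b hb
    obtain ⟨-, ξ', hξ', ⟨m1, hm1⟩, z, hz1, hz2⟩ := hiT.1
    have hca : ∀ y ∈ c, y ∈ x '' Set.Iio i := fun y hy =>
      ⟨j ⟨y, hy⟩, (hb2 _ (hj _)).trans hki, hj2 ⟨y, hy⟩⟩
    have : ξ = ξ' := by
      refine hU ξ hξ ξ' hξ' ⟨max m (max m0 m1), fun n hn => ?_⟩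
      simp only [ge_iff_le, max_le_iff] at hn
      rw [← hm0 n hn.2.1, ← hm1 n hn.2.2]
      exact (hi0 n hn.1).trans (hin n hn.1).symm
    subst this
    exact ⟨z, fun y hy => hz1 y (hca y hy), fun y hy y' hy' => hz2 y (hca y hy) y' (hca y' hy')⟩


/-- moves of the chooser: `((α, γ), (ε, ζ))` -/
abbrev Mv := (Ordinal.{0} × Ordinal.{0}) × (Ordinal.{0} × Ordinal.{0})

/-- admissible answers to the bounds `β`, `b` in round `n` -/
def mvOK (lam : Cardinal.{0}) (lamseq : ℕ → Cardinal.{0}) (n : ℕ) (β b : Ordinal.{0}) (m : Mv) :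
    Prop :=
  β < m.1.1 ∧ m.1.1 < lam.ord ∧ b < m.1.2 ∧ m.1.2 < (lamseq n).ord ∧
    m.2.1 < (lamseq n).ord ∧ m.2.2 < w1

/-- the point treated at a position -/
def ptOf (e : List (Ordinal.{0} × Ordinal.{0}) → ℕ → Ordinal.{0})
    (q : List (Ordinal.{0} × Ordinal.{0})) : Ordinal.{0} :=
  e (q.drop (q.length - q.length.unpair.1)) q.length.unpair.2

/-- legal positions -/
def Legal (lamseq : ℕ → Cardinal.{0}) (P : List (Ordinal.{0} × Ordinal.{0}) → Ordinal.{0})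
    (ξ : Ordinal.{0}) (p : List Mv) : Prop :=
  ∀ m1 q1 m2 q2, (m1 :: q1) <:+ p → (m2 :: q2) <:+ p → m1.2.2 < ξ ∧
    (P (q1.map Prod.fst) < P (q2.map Prod.fst) → m1.2.2 < m2.2.2) ∧
    (P (q1.map Prod.fst) < (lamseq q2.length).ord → P (q1.map Prod.fst) < m2.2.1)

/-- strategy trees of the bounder -/
inductive Tr : Type 1
  | leaf : Tr
  | node (β b : Ordinal.{0}) (c : Mv → Tr) : Tr

/-- the tree `T` wins for the bounder at position `p` -/
def Wins (lam : Cardinal.{0}) (lamseq : ℕ → Cardinal.{0})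
    (P : List (Ordinal.{0} × Ordinal.{0}) → Ordinal.{0}) (ξ : Ordinal.{0}) :
    Tr → List Mv → Prop
  | .leaf, p => ¬ Legal lamseq P ξ p
  | .node β b c, p => β < lam.ord ∧ b < (lamseq p.length).ord ∧
      ∀ m, mvOK lam lamseq p.length β b m → Wins lam lamseq P ξ (c m) (m :: p)

/-- the subtree at a position -/
def sub (T : Tr) : List Mv → Tr
  | [] => T
  | m :: p => match sub T p with
    | .leaf => .leaf
    | .node _ _ c => c m

/-- first bound -/
def bβ : Tr → Ordinal.{0}
  | .leaf => 0
  | .node β _ _ => β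

/-- second bound -/
def bb : Tr → Ordinal.{0}
  | .leaf => 0
  | .node _ b _ => b

theorem not_lost_step {lam : Cardinal.{0}} {lamseq : ℕ → Cardinal.{0}}
    {P : List (Ordinal.{0} × Ordinal.{0}) → Ordinal.{0}} {ξ : Ordinal.{0}} {p : List Mv}
    (h : ∀ T, ¬ Wins lam lamseq P ξ T p) :
    Legal lamseq P ξ p ∧ ∀ β < lam.ord, ∀ b < (lamseq p.length).ord,
      ∃ m, mvOK lam lamseq p.length β b m ∧ ∀ T, ¬ Wins lam lamseq P ξ T (m :: p) := by
  classical
  refine ⟨by simpa [Wins] using h .leaf, fun β hβ b hb => ?_⟩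
  by_contra hcon
  push Not at hcon
  have : ∀ m, ∃ T, mvOK lam lamseq p.length β b m → Wins lam lamseq P ξ T (m :: p) := by
    intro m
    by_cases hm : mvOK lam lamseq p.length β b m
    · obtain ⟨T, hT⟩ := hcon m hm
      exact ⟨T, fun _ => hT⟩
    · exact ⟨.leaf, fun h => absurd h hm⟩
  choose c hc using this
  exact h (.node β b c) ⟨hβ, hb, hc⟩

/-- sequences of longer and longer positions -/
def SeqL {α : Type 1} (Q : ℕ → List α) : Prop := Q 0 = [] ∧ ∀ n, ∃ a, Q (n+1) = a :: Q n

theorem SeqL.length {α : Type 1} {Q : ℕ → List α} (h : SeqL Q) (n : ℕ) : (Q n).length = n := by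
  induction n with
  | zero => simp [h.1]
  | succ n ih => obtain ⟨a, ha⟩ := h.2 n; simp [ha, ih]

theorem SeqL.drop' {α : Type 1} {Q : ℕ → List α} (h : SeqL Q) (k d : ℕ) :
    (Q (k + d)).drop d = Q k := by
  induction d with
  | zero => simp
  | succ d ih => obtain ⟨a, ha⟩ := h.2 (k + d); rw [← add_assoc, ha]; simpa using ih

theorem SeqL.drop {α : Type 1} {Q : ℕ → List α} (h : SeqL Q) {k n : ℕ} (hk : k ≤ n) :
    (Q n).drop (n - k) = Q k := by
  have := h.drop' k (n - k)
  rwa [Nat.add_sub_cancel' hk] at this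

theorem SeqL.suffix {α : Type 1} {Q : ℕ → List α} (h : SeqL Q) {k n : ℕ} (hk : k ≤ n) :
    Q k <:+ Q n := by
  rw [← h.drop hk]; exact List.drop_suffix _ _

theorem SeqL.of_suffix {α : Type 1} {Q : ℕ → List α} (h : SeqL Q) {n : ℕ} {l : List α}
    (hl : l <:+ Q n) : ∃ k ≤ n, l = Q k := by
  induction n with
  | zero =>
    rw [h.1, List.suffix_nil] at hl
    exact ⟨0, le_rfl, by rw [hl, h.1]⟩
  | succ n ih =>
    obtain ⟨a, ha⟩ := h.2 n
    rw [ha, List.suffix_cons_iff] at hl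
    rcases hl with hl | hl
    · exact ⟨n+1, le_rfl, by rw [hl, ha]⟩
    · obtain ⟨k, hk, hk2⟩ := ih hl
      exact ⟨k, hk.trans (Nat.le_succ n), hk2⟩

theorem SeqL.ptOf {e : List (Ordinal.{0} × Ordinal.{0}) → ℕ → Ordinal.{0}}
    {Q : ℕ → List (Ordinal.{0} × Ordinal.{0})} (h : SeqL Q) (n : ℕ) :
    ptOf e (Q n) = e (Q n.unpair.1) n.unpair.2 := by
  unfold ReflSCH.ptOf
  rw [h.length, h.drop (Nat.unpair_left_le n)]

theorem lift_list {X Y : Set Ordinal.{0}} (l : List (Ordinal.{0} × Ordinal.{0}))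
    (h : ∀ e ∈ l, e.1 ∈ X ∧ e.2 ∈ Y) :
    ∃ l' : List (X × Y), l'.map (fun e => (e.1.1, e.2.1)) = l := by
  induction l with
  | nil => exact ⟨[], rfl⟩
  | cons a l ih =>
    obtain ⟨l', hl'⟩ := ih (fun e he => h e (List.mem_cons_of_mem _ he))
    have := h a List.mem_cons_self
    exact ⟨(⟨a.1, this.1⟩, ⟨a.2, this.2⟩) :: l', by simp [hl']⟩

theorem card_list {X Y : Type 1} {c : Cardinal.{1}} (hc : ℵ₀ < c) (hX : #X < c) (hY : #Y < c) :
    #(List (X × Y)) < c := by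
  refine (Cardinal.mk_list_le_max _).trans_lt (max_lt hc ?_)
  rw [Cardinal.mk_prod, Cardinal.lift_id, Cardinal.lift_id]
  exact Cardinal.mul_lt_of_lt hc.le hX hY

/-- ordinals below some earlier `λ_m` -/
def Bset (lamseq : ℕ → Cardinal.{0}) (n : ℕ) : Set Ordinal.{0} :=
  {b | ∃ m < n, b < (lamseq m).ord}

theorem card_Iio_ord (c : Cardinal.{0}) : #(Set.Iio c.ord) = Cardinal.lift.{1} c := by
  rw [Cardinal.mk_Iio_ordinal, Cardinal.card_ord]

theorem card_Bset {lamseq : ℕ → Cardinal.{0}} (hmono : StrictMono lamseq) (n : ℕ)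
    (hpos : 0 < lamseq n) :
    #(Bset lamseq n) < Cardinal.lift.{1} (lamseq n) := by
  cases n with
  | zero =>
    have : Bset lamseq 0 = ∅ := by ext; simp [Bset]
    rw [this]
    simpa [pos_iff_ne_zero] using hpos.ne'
  | succ n =>
    have : Bset lamseq (n+1) ⊆ Set.Iio (lamseq n).ord := by
      rintro b ⟨m, hm, hb⟩
      exact hb.trans_le (Cardinal.ord_le_ord.2 (hmono.monotone (Nat.lt_succ_iff.1 hm)))
    refine (Cardinal.mk_le_mk_of_subset this).trans_lt ?_
    rw [card_Iio_ord, Cardinal.lift_lt]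
    exact hmono (Nat.lt_succ_self n)

theorem exists_rank (N : Set Ordinal.{0}) (hN : N.Countable) :
    ∃ z : Ordinal.{0} → Ordinal.{0}, (∀ x, z x < w1) ∧ ∀ x ∈ N, ∀ y, x < y → z x < z y := by
  have : ∃ z : Ordinal.{0} → Ordinal.{0}, ∀ x, z x = sInf {o | ∀ y ∈ N, y < x → z y < o} := by
    let z : Ordinal.{0} → Ordinal.{0} := (Ordinal.lt_wf).fix
      (fun x rec => sInf {o | ∀ y ∈ N, ∀ h : y < x, rec y h < o})
    refine ⟨z, fun x => ?_⟩
    exact (Ordinal.lt_wf).fix_eq _ x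
  obtain ⟨z, hz⟩ := this
  have key : ∀ x, z x < w1 ∧ ∀ y ∈ N, y < x → z y < z x := by
    intro x
    induction x using Ordinal.induction with
    | h x ih =>
      have : Countable {y // y ∈ N ∧ y < x} := (hN.mono (fun y hy => hy.1)).to_subtype
      obtain ⟨b, hb, hb2⟩ := bd1 (fun y : {y // y ∈ N ∧ y < x} => z y.1)
      have hmem : b ∈ {o | ∀ y ∈ N, y < x → z y < o} :=
        fun y hy hyx => hb2 ⟨y, hy, hyx⟩ (ih y hyx).1
      have h1 := csInf_mem ⟨b, hmem⟩
      rw [← hz x] at h1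
      refine ⟨lt_of_le_of_lt ?_ hb, h1⟩
      rw [hz x]
      exact csInf_le (OrderBot.bddBelow _) hmem
  exact ⟨z, fun x => (key x).1, fun x hx y hxy => (key y).2 x hx hxy⟩

theorem game (lam : Cardinal.{0}) (lamseq : ℕ → Cardinal.{0})
    (hlreg : lam.IsRegular) (hreg : ∀ n, (lamseq n).IsRegular)
    (hbig : ∀ n, Cardinal.aleph 1 < lamseq n) (hmono : StrictMono lamseq)
    (hlt : ∀ n, lamseq n < lam)
    (e : List (Ordinal.{0} × Ordinal.{0}) → ℕ → Ordinal.{0}) :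
    ∃ ξ < w1, ∀ T, ¬ Wins lam lamseq (ptOf e) ξ T [] := by
  classical
  by_contra hcon
  push Not at hcon
  have : ∀ ξ, ∃ T, ξ < w1 → Wins lam lamseq (ptOf e) ξ T [] := by
    intro ξ
    by_cases h : ξ < w1
    · obtain ⟨T, hT⟩ := hcon ξ h
      exact ⟨T, fun _ => hT⟩
    · exact ⟨.leaf, fun h' => absurd h' h⟩
  choose T hT using this
  have hinf : ∀ n, ℵ₀ < Cardinal.lift.{1} (lamseq n) := by
    intro n
    rw [← Cardinal.lift_aleph0.{1,0}, Cardinal.lift_lt]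
    exact Cardinal.aleph0_lt_aleph_one.trans (hbig n)
  have hidx : ∀ n, #(Set.Iio w1 × List (Bset lamseq n × Set.Iio w1)) <
      Cardinal.lift.{1} (lamseq n) := by
    intro n
    have hw : #(Set.Iio w1) < Cardinal.lift.{1} (lamseq n) := by
      rw [card_Iio_ord, Cardinal.lift_lt]; exact hbig n
    rw [Cardinal.mk_prod, Cardinal.lift_id, Cardinal.lift_id]
    refine Cardinal.mul_lt_of_lt (hinf n).le hw (card_list (hinf n) ?_ hw)
    exact card_Bset hmono n (hreg n).pos
  have step : ∀ q : List (Ordinal.{0} × Ordinal.{0}), ∃ ag : Ordinal.{0} × Ordinal.{0},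
      ag.1 < lam.ord ∧ ag.2 < (lamseq q.length).ord ∧ ∀ ξ < w1,
      ∀ l : List (Ordinal.{0} × Ordinal.{0}),
        (∀ x ∈ l, x.1 ∈ Bset lamseq q.length ∧ x.2 ∈ Set.Iio w1) →
        (bβ (sub (T ξ) (q.zip l)) < lam.ord → bβ (sub (T ξ) (q.zip l)) < ag.1) ∧
        (bb (sub (T ξ) (q.zip l)) < (lamseq q.length).ord →
          bb (sub (T ξ) (q.zip l)) < ag.2) := by
    intro q
    obtain ⟨α, hα, hα2⟩ := bd lam hlreg
      (fun i : Set.Iio w1 × List (Bset lamseq q.length × Set.Iio w1) =>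
        bβ (sub (T i.1.1) (q.zip (i.2.map (fun e => (e.1.1, e.2.1))))))
      ((hidx _).trans (Cardinal.lift_lt.2 (hlt _)))
    obtain ⟨γ, hγ, hγ2⟩ := bd (lamseq q.length) (hreg _)
      (fun i : Set.Iio w1 × List (Bset lamseq q.length × Set.Iio w1) =>
        bb (sub (T i.1.1) (q.zip (i.2.map (fun e => (e.1.1, e.2.1))))))
      (hidx _)
    refine ⟨(α, γ), hα, hγ, fun ξ hξ l hl => ?_⟩
    obtain ⟨l', rfl⟩ := lift_list l hl
    exact ⟨hα2 (⟨ξ, hξ⟩, l'), hγ2 (⟨ξ, hξ⟩, l')⟩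
  choose ag ag1 ag2 ag3 using step
  let Q : ℕ → List (Ordinal.{0} × Ordinal.{0}) := fun n => Nat.rec [] (fun _ q => ag q :: q) n
  have hQ : SeqL Q := ⟨rfl, fun n => ⟨_, rfl⟩⟩
  let N : Set Ordinal.{0} := ⋃ n, Set.range (e (Q n))
  have hN : N.Countable := Set.countable_iUnion fun n => Set.countable_range _
  have hptN : ∀ n, ptOf e (Q n) ∈ N := by
    intro n
    rw [hQ.ptOf]
    exact Set.mem_iUnion.2 ⟨_, _, rfl⟩
  have hNc : Countable N := hN.to_subtype
  have hε : ∀ n, ∃ ε < (lamseq n).ord, ∀ x ∈ N, x < (lamseq n).ord → x < ε := by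
    intro n
    obtain ⟨b, hb, hb2⟩ := bd (lamseq n) (hreg n) (fun x : N => x.1)
      ((Cardinal.mk_le_aleph0).trans_lt (hinf n))
    exact ⟨b, hb, fun x hx => hb2 ⟨x, hx⟩⟩
  choose ε hε1 hε2 using hε
  obtain ⟨z, hz1, hz2⟩ := exists_rank N hN
  obtain ⟨ξ, hξ, hξ2⟩ := bd1 (fun x : N => z x.1)
  let L : ℕ → List (Ordinal.{0} × Ordinal.{0}) :=
    fun n => Nat.rec [] (fun n l => (ε n, z (ptOf e (Q n))) :: l) n
  have hL : SeqL L := ⟨rfl, fun n => ⟨_, rfl⟩⟩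
  have hLmem : ∀ n, ∀ x ∈ L n, x.1 ∈ Bset lamseq n ∧ x.2 ∈ Set.Iio w1 := by
    intro n
    induction n with
    | zero => intro x hx; simp [L] at hx
    | succ n ih =>
      intro x hx
      have hx' : x ∈ (ε n, z (ptOf e (Q n))) :: L n := hx
      rw [List.mem_cons] at hx'
      rcases hx' with rfl | hx'
      · exact ⟨⟨n, Nat.lt_succ_self n, hε1 n⟩, hz1 _⟩
      · obtain ⟨⟨m, hm, h1⟩, h2⟩ := ih x hx'
        exact ⟨⟨m, hm.trans (Nat.lt_succ_self n), h1⟩, h2⟩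
  let p : ℕ → List Mv := fun n => (Q n).zip (L n)
  let mv : ℕ → Mv := fun n => (ag (Q n), (ε n, z (ptOf e (Q n))))
  have hp1 : ∀ n, p (n+1) = mv n :: p n := fun n => rfl
  have hp : SeqL p := ⟨rfl, fun n => ⟨_, hp1 n⟩⟩
  have hpQ : ∀ n, (p n).map Prod.fst = Q n := by
    intro n
    exact List.map_fst_zip (by rw [hQ.length, hL.length])
  have hlegal : ∀ n, Legal lamseq (ptOf e) ξ (p n) := by
    intro n
    have aux : ∀ m q, (m :: q) <:+ p n → ∃ k, m = mv k ∧ q = p k := by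
      intro m q h
      obtain ⟨k, -, hk⟩ := hp.of_suffix h
      cases k with
      | zero => rw [hp.1] at hk; simp at hk
      | succ k =>
        rw [hp1, List.cons.injEq] at hk
        exact ⟨k, hk⟩
    intro m1 q1 m2 q2 h1 h2
    obtain ⟨i, rfl, rfl⟩ := aux _ _ h1
    obtain ⟨j, rfl, rfl⟩ := aux _ _ h2
    rw [hpQ, hpQ, hp.length]
    refine ⟨hξ2 ⟨_, hptN i⟩ (hz1 _), hz2 _ (hptN i) _, hε2 j _ (hptN i)⟩
  have fin : ∀ (S : Tr) (n : ℕ), S = sub (T ξ) (p n) → Wins lam lamseq (ptOf e) ξ S (p n) →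
      False := by
    intro S
    induction S with
    | leaf => intro n _ h; exact h (hlegal n)
    | node β b c ih =>
      intro n hS hW
      obtain ⟨hβ, hb, hW⟩ := hW
      rw [hp.length] at hb hW
      have h3 := ag3 (Q n) ξ hξ (L n) (by rw [hQ.length]; exact hLmem n)
      have hS' : sub (T ξ) ((Q n).zip (L n)) = .node β b c := hS.symm
      rw [hS', hQ.length] at h3
      refine ih (mv n) (n+1) ?_ ?_
      · rw [hp1]; simp only [sub]; rw [← hS]
      · rw [hp1]
        refine hW _ ⟨h3.1 hβ, ag1 _, h3.2 hb, ?_, hε1 n, hz1 _⟩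
        have := ag2 (Q n)
        rw [hQ.length] at this
        exact this
  exact fin (T ξ) 0 rfl (hT ξ hξ)

theorem slow (N : ℕ → ℕ) : ∃ κ : ℕ → ℕ, Monotone κ ∧ (∀ k, ∃ n, k ≤ κ n) ∧
    ∀ n ≥ N 0, N (κ n) ≤ n := by
  classical
  refine ⟨fun n => Nat.findGreatest (fun k => ∀ j ≤ k, N j ≤ n) n, ?_, ?_, ?_⟩
  · intro a b hab
    exact Nat.findGreatest_mono (fun k hk j hj => (hk j hj).trans hab) hab
  · intro k
    refine ⟨k + ∑ j ∈ Finset.range (k+1), N j, ?_⟩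
    refine Nat.le_findGreatest (Nat.le_add_right _ _) ?_
    intro j hj
    refine le_trans ?_ (Nat.le_add_left _ _)
    exact Finset.single_le_sum (f := N) (fun _ _ => Nat.zero_le _)
      (Finset.mem_range.2 (Nat.lt_succ_of_le hj))
  · intro n hn
    have := Nat.findGreatest_spec (P := fun k => ∀ j ≤ k, N j ≤ n) (Nat.zero_le n)
      (by intro j hj; rw [Nat.le_zero.1 hj]; exact hn)
    exact this _ le_rfl


/-- closing off along a position -/
def Cfun (K : Set Ordinal.{0} → Set Ordinal.{0}) (lam : Cardinal.{0}) :
    List (Ordinal.{0} × Ordinal.{0}) → Set Ordinal.{0}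
  | [] => K (Set.range (fun n : ℕ => (n : Ordinal.{0})))
  | ag :: q => K (Cfun K lam q ∪ ({ag.1, ag.2} ∩ Set.Iio lam.ord))

/-- the run of the strategy -/
def run (τ : List Mv → Ordinal.{0} × Ordinal.{0} → Mv) :
    List (Ordinal.{0} × Ordinal.{0}) → List Mv
  | [] => []
  | h :: s => τ (run τ s) h :: run τ s

theorem stepD (μ lam : Cardinal.{0}) (lamseq : ℕ → Cardinal.{0})
    (f : Ordinal.{0} → ℕ → Ordinal.{0}) (hμl : μ < lam)
    (hlreg : lam.IsRegular) (hreg : ∀ n, (lamseq n).IsRegular)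
    (hbig : ∀ n, Cardinal.aleph 1 < lamseq n) (hmono : StrictMono lamseq)
    (hle : ∀ n, lamseq n ≤ μ) (hf : TcfWitness lam lamseq f)
    (e : List (Ordinal.{0} × Ordinal.{0}) → ℕ → Ordinal.{0})
    (τ : List Mv → Ordinal.{0} × Ordinal.{0} → Mv) (D : List Ordinal.{0}) :
    ∃ δ' < lam.ord, (∀ d ∈ D, d < lam.ord → d < δ') ∧
      (∀ s : List (Ordinal.{0} × Ordinal.{0}), (∀ h ∈ s, h.1 ∈ D ∧ h.2 < μ.ord) → ∀ j,
        e ((run τ s).map Prod.fst) j < lam.ord → e ((run τ s).map Prod.fst) j < δ') ∧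
      ∃ g : ℕ → Ordinal.{0}, ∃ α < δ', ltBd g (f α) ∧
        ∀ n, ∀ s : List (Ordinal.{0} × Ordinal.{0}),
          (∀ h ∈ s, h.1 ∈ D ∧ h.2 ∈ Bset lamseq n) → ∀ d ∈ D,
          (τ (run τ s) (d, 0)).2.1 < (lamseq n).ord → (τ (run τ s) (d, 0)).2.1 < g n := by
  classical
  have hinf : ∀ n, ℵ₀ < Cardinal.lift.{1} (lamseq n) := by
    intro n
    rw [← Cardinal.lift_aleph0.{1,0}, Cardinal.lift_lt]
    exact Cardinal.aleph0_lt_aleph_one.trans (hbig n)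
  have hinfl : ℵ₀ < Cardinal.lift.{1} lam :=
    (hinf 0).trans (Cardinal.lift_lt.2 ((hle 0).trans_lt hμl))
  let X : Set Ordinal.{0} := {x | x ∈ D}
  have hXfin : X.Finite := D.finite_toSet
  have hX : #X < ℵ₀ := Cardinal.lt_aleph0_iff_set_finite.2 hXfin
  obtain ⟨b1, hb1, hb1'⟩ := bd lam hlreg
    (fun i : List (X × Set.Iio μ.ord) × ULift.{1} ℕ =>
      e ((run τ (i.1.map (fun e => (e.1.1, e.2.1)))).map Prod.fst) i.2.down) (by
    rw [Cardinal.mk_prod, Cardinal.lift_id, Cardinal.lift_id]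
    refine Cardinal.mul_lt_of_lt hinfl.le (card_list hinfl (hX.trans hinfl) ?_) ?_
    · rw [card_Iio_ord, Cardinal.lift_lt]; exact hμl
    · exact (Cardinal.mk_le_aleph0).trans_lt hinfl)
  obtain ⟨b2, hb2, hb2'⟩ := bd lam hlreg (fun i : X => i.1) (hX.trans hinfl)
  have : ∀ n, ∃ b < (lamseq n).ord, ∀ s : List (Ordinal.{0} × Ordinal.{0}),
          (∀ h ∈ s, h.1 ∈ D ∧ h.2 ∈ Bset lamseq n) → ∀ d ∈ D,
          (τ (run τ s) (d, 0)).2.1 < (lamseq n).ord → (τ (run τ s) (d, 0)).2.1 < b := by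
    intro n
    obtain ⟨b, hb, hb'⟩ := bd (lamseq n) (hreg n)
      (fun i : List (X × Bset lamseq n) × X =>
        (τ (run τ (i.1.map (fun e => (e.1.1, e.2.1)))) (i.2.1, 0)).2.1) (by
      rw [Cardinal.mk_prod, Cardinal.lift_id, Cardinal.lift_id]
      exact Cardinal.mul_lt_of_lt (hinf n).le (card_list (hinf n) (hX.trans (hinf n))
        (card_Bset hmono n (hreg n).pos)) (hX.trans (hinf n)))
    refine ⟨b, hb, fun s hs d hd => ?_⟩
    obtain ⟨l', rfl⟩ := lift_list (X := X) s hs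
    exact hb' (l', ⟨d, hd⟩)
  choose g hg hg' using this
  obtain ⟨α, hα, hgα⟩ := hf.2.2 g hg
  refine ⟨max (max b1 b2) (Order.succ α), ?_, ?_, ?_, g, α, ?_, hgα, hg'⟩
  · exact max_lt (max_lt hb1 hb2) ((Cardinal.isSuccLimit_ord hlreg.aleph0_le).succ_lt hα)
  · intro d hd hdl
    exact (hb2' ⟨d, hd⟩ hdl).trans_le ((le_max_right _ _).trans (le_max_left _ _))
  · intro s hs j hj
    obtain ⟨l', rfl⟩ := lift_list (X := X) (Y := Set.Iio μ.ord) s hs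
    exact (hb1' (l', ⟨j⟩) hj).trans_le ((le_max_left _ _).trans (le_max_left _ _))
  · exact (Order.lt_succ α).trans_le (le_max_right _ _)

theorem meets (μ lam : Cardinal.{0}) (lamseq : ℕ → Cardinal.{0})
    (f : Ordinal.{0} → ℕ → Ordinal.{0}) (U : Ordinal.{0} → Set ℕ) (hμl : μ < lam)
    (hlreg : lam.IsRegular) (hreg : ∀ n, (lamseq n).IsRegular)
    (hbig : ∀ n, Cardinal.aleph 1 < lamseq n) (hmono : StrictMono lamseq)
    (hle : ∀ n, lamseq n ≤ μ) (hf : TcfWitness lam lamseq f) :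
    MeetsClubs (Set.Iio lam.ord) (fam lam lamseq f U) := by
  classical
  intro 𝒞 ⟨hCs, hCc, hCu⟩
  have hlt : ∀ n, lamseq n < lam := fun n => (hle n).trans_lt hμl
  have hlto : ∀ n, (lamseq n).ord < lam.ord := fun n => Cardinal.ord_lt_ord.2 (hlt n)
  have hseqpos : ∀ n, 0 < (lamseq n).ord := by
    intro n; rw [Cardinal.lt_ord]; simpa using (hreg n).pos
  have hlpos : 0 < lam.ord := (hseqpos 0).trans (hlto 0)
  have hK : ∀ y : Set Ordinal.{0}, ∃ x ∈ 𝒞, y ∈ small (Set.Iio lam.ord) → y ⊆ x := by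
    intro y
    by_cases hy : y ∈ small (Set.Iio lam.ord)
    · obtain ⟨x, hx, hyx⟩ := hCu y hy
      exact ⟨x, hx, fun _ => hyx⟩
    · obtain ⟨x, hx, -⟩ := hCu ∅ ⟨by simp, by simp⟩
      exact ⟨x, hx, fun h => absurd h hy⟩
  choose K hK1 hK2 using hK
  have hCm : ∀ q, Cfun K lam q ∈ 𝒞 := by
    intro q; cases q <;> exact hK1 _
  have hCs' : ∀ q, Cfun K lam q ∈ small (Set.Iio lam.ord) := fun q => hCs (hCm q)
  have hCcons : ∀ ag q, Cfun K lam q ∪ ({ag.1, ag.2} ∩ Set.Iio lam.ord) ⊆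
      Cfun K lam (ag :: q) := by
    intro ag q
    refine hK2 _ ⟨Set.union_subset (hCs' q).1 Set.inter_subset_right, ?_⟩
    exact (hCs' q).2.union ((Set.toFinite {ag.1, ag.2}).countable.mono Set.inter_subset_left)
  have hCnil : Set.range (fun n : ℕ => (n : Ordinal.{0})) ⊆ Cfun K lam [] := by
    refine hK2 _ ⟨?_, Set.countable_range _⟩
    rintro _ ⟨n, rfl⟩
    refine lt_of_lt_of_le (Ordinal.natCast_lt_omega0 n) ?_
    rw [← Cardinal.ord_aleph0]
    exact Cardinal.ord_le_ord.2 hlreg.aleph0_le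
  have hCne : ∀ q, (Cfun K lam q).Nonempty := by
    intro q
    induction q with
    | nil => exact ⟨_, hCnil ⟨0, rfl⟩⟩
    | cons ag q ih => exact ih.mono (Set.subset_union_left.trans (hCcons ag q))
  have he : ∀ q, ∃ e : ℕ → Ordinal.{0}, Cfun K lam q = Set.range e :=
    fun q => (hCs' q).2.exists_eq_range (hCne q)
  choose e he using he
  obtain ⟨ξ, hξ, hnl⟩ := game lam lamseq hlreg hreg hbig hmono hlt e
  have hτ : ∀ (p : List Mv) (x : Ordinal.{0} × Ordinal.{0}), ∃ m : Mv,
      (∀ T, ¬ Wins lam lamseq (ptOf e) ξ T p) → x.1 < lam.ord → x.2 < (lamseq p.length).ord →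
      mvOK lam lamseq p.length x.1 x.2 m ∧ ∀ T, ¬ Wins lam lamseq (ptOf e) ξ T (m :: p) := by
    intro p x
    by_cases h : (∀ T, ¬ Wins lam lamseq (ptOf e) ξ T p) ∧ x.1 < lam.ord ∧
      x.2 < (lamseq p.length).ord
    · obtain ⟨m, hm⟩ := (not_lost_step h.1).2 x.1 h.2.1 x.2 h.2.2
      exact ⟨m, fun _ _ _ => hm⟩
    · exact ⟨((0, 0), (0, 0)), fun h1 h2 h3 => absurd ⟨h1, h2, h3⟩ h⟩
  choose τ hτ using hτ
  have hst := stepD μ lam lamseq f hμl hlreg hreg hbig hmono hle hf e τ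
  choose nx hnx1 hnx2 hnx3 G α hα hGα hG using hst
  let Dk : ℕ → List Ordinal.{0} := fun k => Nat.rec [0] (fun _ D => nx D :: D) k
  have hDk : ∀ k, Dk (k+1) = nx (Dk k) :: Dk k := fun _ => rfl
  have hDlam : ∀ k, ∀ x ∈ Dk k, x < lam.ord := by
    intro k
    induction k with
    | zero => intro x hx; simp [Dk] at hx; rw [hx]; exact hlpos
    | succ k ih =>
      intro x hx
      rw [hDk, List.mem_cons] at hx
      rcases hx with rfl | hx
      · exact hnx1 _
      · exact ih x hx
  have hDmono : ∀ k l, k ≤ l → ∀ x ∈ Dk k, x ∈ Dk l := by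
    intro k l hkl
    induction hkl with
    | refl => exact fun x hx => hx
    | step _ ih => exact fun x hx => List.mem_cons_of_mem _ (ih x hx)
  let d : ℕ → Ordinal.{0} := fun k => Nat.casesOn k 0 (fun k => nx (Dk k))
  have hd1 : ∀ k, d (k+1) = nx (Dk k) := fun _ => rfl
  have hdD : ∀ k, d k ∈ Dk k := by
    intro k
    cases k with
    | zero => simp [d, Dk]
    | succ k => rw [hDk, hd1]; exact List.mem_cons_self
  have hdlam : ∀ k, d k < lam.ord := fun k => hDlam k _ (hdD k)
  have hdmono : StrictMono d := strictMono_nat_of_lt_succ fun k => by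
    rw [hd1]; exact hnx2 _ _ (hdD k) (hdlam k)
  obtain ⟨δ, hδlub, hδlam⟩ : ∃ δ, IsLUB (Set.range d) δ ∧ δ < lam.ord := by
    obtain ⟨b, hb, hb'⟩ := bd lam hlreg (fun i : ULift.{1} ℕ => d i.down) (by
      refine (Cardinal.mk_le_aleph0).trans_lt ?_
      rw [← Cardinal.lift_aleph0.{1,0}, Cardinal.lift_lt]
      exact Cardinal.aleph0_lt_aleph_one.trans ((hbig 0).trans (hlt 0)))
    have hub : b ∈ upperBounds (Set.range d) := by
      rintro _ ⟨k, rfl⟩; exact (hb' ⟨k⟩ (hdlam k)).le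
    refine ⟨sSup (Set.range d), isLUB_csSup (Set.range_nonempty d) ⟨b, hub⟩, ?_⟩
    exact (csSup_le (Set.range_nonempty d) hub).trans_lt hb
  have hdδ : ∀ k, d k < δ := fun k => (hdmono (Nat.lt_succ_self k)).trans_le (hδlub.1 ⟨k+1, rfl⟩)
  have hN : ∀ k, ∃ N, ∀ n ≥ N, G (Dk k) n < f δ n := by
    intro k
    obtain ⟨m1, h1⟩ := hGα (Dk k)
    have hαd : α (Dk k) < δ := (hα (Dk k)).trans (hdδ (k+1))
    obtain ⟨m2, h2⟩ := hf.2.1 (α (Dk k)) (hαd.trans hδlam) δ hδlam hαd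
    exact ⟨max m1 m2, fun n hn => (h1 n (le_of_max_le_left hn)).trans (h2 n (le_of_max_le_right hn))⟩
  choose N hN using hN
  obtain ⟨κ, hκm, hκu, hκN⟩ := slow N
  let h : ℕ → Ordinal.{0} × Ordinal.{0} := fun n => (d (κ n), if n ∈ U ξ then 0 else f δ n)
  have hh2 : ∀ n, (h n).2 < (lamseq n).ord := by
    intro n
    simp only [h]
    split_ifs
    · exact hseqpos n
    · exact hf.1 δ hδlam n
  let s : ℕ → List (Ordinal.{0} × Ordinal.{0}) := fun n => Nat.rec [] (fun n l => h n :: l) n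
  have hs1 : ∀ n, s (n+1) = h n :: s n := fun _ => rfl
  have hsmem : ∀ n, ∀ x ∈ s n, ∃ m < n, x = h m := by
    intro n
    induction n with
    | zero => intro x hx; simp [s] at hx
    | succ n ih =>
      intro x hx
      rw [hs1, List.mem_cons] at hx
      rcases hx with rfl | hx
      · exact ⟨n, Nat.lt_succ_self n, rfl⟩
      · obtain ⟨m, hm, hx⟩ := ih x hx
        exact ⟨m, hm.trans (Nat.lt_succ_self n), hx⟩
  have hsD : ∀ n, ∀ x ∈ s n, x.1 ∈ Dk (κ n) ∧ x.2 ∈ Bset lamseq n := by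
    intro n x hx
    obtain ⟨m, hm, rfl⟩ := hsmem n x hx
    exact ⟨hDmono _ _ (hκm hm.le) _ (hdD _), m, hm, hh2 m⟩
  have hsD' : ∀ n, ∀ x ∈ s n, x.1 ∈ Dk (κ n) ∧ x.2 < μ.ord := by
    intro n x hx
    obtain ⟨h1, m, hm, h2⟩ := hsD n x hx
    exact ⟨h1, h2.trans_le (Cardinal.ord_le_ord.2 (hle m))⟩
  let R : ℕ → List Mv := fun n => run τ (s n)
  let mv : ℕ → Mv := fun n => τ (R n) (h n)
  have hR1 : ∀ n, R (n+1) = mv n :: R n := fun _ => rfl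
  have hR : SeqL R := ⟨rfl, fun n => ⟨_, hR1 n⟩⟩
  have hstep : ∀ n, (∀ T, ¬ Wins lam lamseq (ptOf e) ξ T (R n)) →
      mvOK lam lamseq n (h n).1 (h n).2 (mv n) ∧
        ∀ T, ¬ Wins lam lamseq (ptOf e) ξ T (mv n :: R n) := by
    intro n hn
    have := hτ (R n) (h n) hn (hdlam _) (by rw [hR.length]; exact hh2 n)
    rwa [hR.length] at this
  have hRn : ∀ n, ∀ T, ¬ Wins lam lamseq (ptOf e) ξ T (R n) := by
    intro n
    induction n with
    | zero => exact hnl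
    | succ n ih => rw [hR1]; exact (hstep n ih).2
  have hok : ∀ n, mvOK lam lamseq n (h n).1 (h n).2 (mv n) := fun n => (hstep n (hRn n)).1
  have hleg : ∀ n, Legal lamseq (ptOf e) ξ (R n) := fun n => (not_lost_step (hRn n)).1
  let Q : ℕ → List (Ordinal.{0} × Ordinal.{0}) := fun n => (R n).map Prod.fst
  have hQ1 : ∀ n, Q (n+1) = (mv n).1 :: Q n := fun _ => rfl
  have hQ : SeqL Q := ⟨rfl, fun n => ⟨_, hQ1 n⟩⟩
  have hL : ∀ i j, (mv i).2.2 < ξ ∧ (ptOf e (Q i) < ptOf e (Q j) → (mv i).2.2 < (mv j).2.2) ∧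
      (ptOf e (Q i) < (lamseq j).ord → ptOf e (Q i) < (mv j).2.1) := by
    intro i j
    have := hleg (max i j + 1) (mv i) (R i) (mv j) (R j)
      (hR.suffix (k := i+1) (Nat.succ_le_succ (le_max_left _ _)))
      (hR.suffix (k := j+1) (Nat.succ_le_succ (le_max_right _ _)))
    rwa [hR.length] at this
  let a : Set Ordinal.{0} := ⋃ n, Cfun K lam (Q n)
  have hCmono : Monotone (fun n => Cfun K lam (Q n)) := monotone_nat_of_le_succ fun n => by
    simp only [hQ1]
    exact Set.subset_union_left.trans (hCcons _ _)
  have haC : a ∈ 𝒞 := by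
    have := hCc (Set.range (fun n => Cfun K lam (Q n))) (by rintro _ ⟨n, rfl⟩; exact hCm _)
      (Set.range_nonempty _) (by
        rintro _ ⟨m, rfl⟩ _ ⟨n, rfl⟩ _
        rcases le_total m n with hmn | hmn
        · exact Or.inl (hCmono hmn)
        · exact Or.inr (hCmono hmn)) (Set.countable_range _)
    rwa [Set.sUnion_range] at this
  have hinf : a.Infinite := by
    have : (Set.range (fun n : ℕ => (n : Ordinal.{0}))).Infinite :=
      Set.infinite_range_of_injective Nat.cast_injective
    refine this.mono (hCnil.trans ?_)
    exact Set.subset_iUnion (fun n => Cfun K lam (Q n)) 0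
  have haδ : ∀ y ∈ a, y < δ := by
    intro y hy
    obtain ⟨n, hn⟩ := Set.mem_iUnion.1 hy
    have hyl : y < lam.ord := (hCs' _).1 hn
    rw [he] at hn
    obtain ⟨j, rfl⟩ := hn
    exact (hnx3 (Dk (κ n)) (s n) (hsD' n) j hyl).trans (hdδ (κ n + 1))
  have hαa : ∀ n, (mv n).1.1 ∈ a := fun n => Set.mem_iUnion.2 ⟨n+1, by
    rw [hQ1]; exact hCcons _ _ (Or.inr ⟨by simp, (hok n).2.1⟩)⟩
  have hγa : ∀ n, (mv n).1.2 ∈ a := fun n => Set.mem_iUnion.2 ⟨n+1, by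
    rw [hQ1]; exact hCcons _ _ (Or.inr ⟨by simp, (hok n).2.2.2.1.trans (hlto n)⟩)⟩
  have hsup : sSup a = δ := by
    refine IsLUB.csSup_eq ⟨fun y hy => (haδ y hy).le, fun u hu => hδlub.2 ?_⟩ ⟨_, hαa 0⟩
    rintro _ ⟨k, rfl⟩
    obtain ⟨n, hn⟩ := hκu k
    exact ((hdmono.monotone hn).trans (hok n).1.le).trans (hu (hαa n))
  have hpt : ∀ y ∈ a, ∃ i, ptOf e (Q i) = y := by
    intro y hy
    obtain ⟨n, hn⟩ := Set.mem_iUnion.1 hy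
    rw [he] at hn
    obtain ⟨j, rfl⟩ := hn
    exact ⟨Nat.pair n j, by rw [hQ.ptOf, Nat.unpair_pair]⟩
  refine ⟨a, ⟨⟨(hCs haC).1, (hCs haC).2, hinf⟩, ξ, hξ, ⟨N 0, fun n hn => ?_⟩, ?_⟩, haC⟩
  · constructor
    · intro hu
      by_contra hnU
      have h1 := hu _ (hγa n) (hok n).2.2.2.1
      rw [hsup] at h1
      have h2 := (hok n).2.2.1
      simp only [h, if_neg hnU] at h2
      exact lt_asymm h1 h2
    · intro hnU y hy hyn
      rw [hsup]
      obtain ⟨i, rfl⟩ := hpt y hy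
      have h1 := (hL i n).2.2 hyn
      have h2 := hG (Dk (κ n)) n (s n) (hsD n) (d (κ n)) (hdD _)
      have h3 : τ (run τ (s n)) (d (κ n), 0) = mv n := by
        simp only [mv, h, if_pos hnU, R]
      rw [h3] at h2
      exact (h1.trans (h2 (hok n).2.2.2.2.1)).trans (hN _ n (hκN n hn))
  · have : ∀ y, ∃ i, y ∈ a → ptOf e (Q i) = y := by
      intro y
      by_cases hy : y ∈ a
      · obtain ⟨i, hi⟩ := hpt y hy
        exact ⟨i, fun _ => hi⟩
      · exact ⟨0, fun h => absurd h hy⟩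
    choose ι hι using this
    refine ⟨fun y => (mv (ι y)).2.2, fun x _ => (hL _ 0).1, fun x hx y hy hxy => ?_⟩
    refine (hL (ι x) (ι y)).2.1 ?_
    rw [hι x hx, hι y hy]
    exact hxy

/-- if `μ` is singular of cofinality `ℵ₀`, `λ = μ⁺`, `⟨λ_n⟩` is a strictly
increasing sequence of regular cardinals `> ℵ₁` with supremum `μ`, and `⟨f_α : α < λ⟩`
witnesses `λ = tcf(∏ λ_n, <_{J^bd_ω})` and is `ℵ₂`-free (i.e. its restriction to any
index set of cardinality `≤ ℵ₁` is free), then some stationary `𝒜 ⊆ [λ]^{ℵ₀}` does not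
reflect in any `A ⊆ λ` of cardinality `ℵ₁`. -/
theorem stmt1 (μ lam : Cardinal.{0}) (lamseq : ℕ → Cardinal.{0})
    (f : Ordinal.{0} → ℕ → Ordinal.{0})
    (hμ : ℵ₀ < μ) (hcf : μ.ord.cof = ℵ₀)
    (hlam : lam = Order.succ μ)
    (hreg : ∀ n : ℕ, (lamseq n).IsRegular)
    (hbig : ∀ n : ℕ, Cardinal.aleph 1 < lamseq n)
    (hmono : StrictMono lamseq)
    (hsup : ⨆ n : ℕ, lamseq n = μ)
    (hf : TcfWitness lam lamseq f)
    (hfree : ∀ I : Set Ordinal.{0}, I ⊆ Set.Iio lam.ord →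
      #I ≤ Cardinal.aleph 1 → Free I f) :
    ∃ 𝒜 : Set (Set Ordinal.{0}), 𝒜 ⊆ ctblInf (Set.Iio lam.ord) ∧
      StatFam (Set.Iio lam.ord) 𝒜 ∧
      ∀ A : Set Ordinal.{0}, A ⊆ Set.Iio lam.ord → #A = Cardinal.aleph 1 →
        ¬ Reflects 𝒜 A := by
  have hle : ∀ n, lamseq n ≤ μ := fun n => by
    rw [← hsup]; exact le_ciSup (Cardinal.bddAbove_range lamseq) n
  have hμl : μ < lam := by rw [hlam]; exact Order.lt_succ μ
  have hlreg : lam.IsRegular := by rw [hlam]; exact Cardinal.isRegular_succ hμ.le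
  have h1 : Cardinal.aleph 1 < lam := (hbig 0).trans ((hle 0).trans_lt hμl)
  obtain ⟨U, hU⟩ := exists_U
  refine ⟨fam lam lamseq f U, fun a ha => ha.1, ⟨fun a ha => ⟨ha.1.1, ha.1.2.1⟩, ?_⟩, ?_⟩
  · exact meets μ lam lamseq f U hμl hlreg hreg hbig hmono hle hf
  · intro A hA hA1
    exact not_reflects lam lamseq f U hU (Cardinal.isSuccLimit_ord hlreg.aleph0_le) hlreg h1
      hfree A hA hA1

end ReflSCH
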